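/- arXiv:1607.04954 — 7 statements merged into one kernel-verified Lean document; each statement's English description precedes it below -/
import Mathlib

section
/- For i = 1,2 and all real x, y with 0 < x < 1 and 0 < y < 1, one has (1/9)·(min(x,y))² ≤ Φⁱ(x,y) ≤ (max(x,y))². -/
/-- The generating-function polynomial Φ¹. -/
noncomputable def Phi1 (x y : ℝ) : ℝ :=
  (15*x^2 + 8*x*y + y^2 + 2*x^2*y + 4*x^3) / 30

/-- The generating-function polynomial Φ². -/
noncomputable def Phi2 (x y : ℝ) : ℝ :=
  (5*x^2 + 11*x*y + 2*y^2 + 14*x^2*y + 8*x^3 + 5*x*y^2) / 45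

/-- For i = 1,2 and all real x, y with 0 < x < 1 and 0 < y < 1, one has
(1/9)·(min(x,y))² ≤ Φⁱ(x,y) ≤ (max(x,y))². -/
theorem phi_bounds (x y : ℝ) (hx0 : 0 < x) (hx1 : x < 1) (hy0 : 0 < y) (hy1 : y < 1) :
    ((1/9 : ℝ) * (min x y)^2 ≤ Phi1 x y ∧ Phi1 x y ≤ (max x y)^2) ∧
    ((1/9 : ℝ) * (min x y)^2 ≤ Phi2 x y ∧ Phi2 x y ≤ (max x y)^2) := by
  have hm : 0 < min x y := lt_min hx0 hy0
  have hmx : min x y ≤ x := min_le_left x y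
  have hmy : min x y ≤ y := min_le_right x y
  have hxM : x ≤ max x y := le_max_left x y
  have hyM : y ≤ max x y := le_max_right x y
  generalize min x y = m at *
  generalize max x y = M at *
  have hxx : m ^ 2 ≤ x ^ 2 := by gcongr
  have hyy : m ^ 2 ≤ y ^ 2 := by gcongr
  have hxy : m ^ 2 ≤ x * y := by rw [sq]; gcongr
  have hxx' : x ^ 2 ≤ M ^ 2 := by gcongr
  have hyy' : y ^ 2 ≤ M ^ 2 := by gcongr
  have hxy' : x * y ≤ M ^ 2 := by
    rw [sq]
    exact mul_le_mul hxM hyM hy0.le (hx0.le.trans hxM)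
  have hxxx : x ^ 3 ≤ x ^ 2 := pow_le_pow_of_le_one hx0.le hx1.le (by norm_num)
  have hxxy : x ^ 2 * y ≤ x ^ 2 := mul_le_of_le_one_right (by positivity) hy1.le
  have hxyy : x * y ^ 2 ≤ y ^ 2 := mul_le_of_le_one_left (by positivity) hx1.le
  have hxxx₀ : 0 < x ^ 3 := by positivity
  have hxxy₀ : 0 < x ^ 2 * y := by positivity
  have hxyy₀ : 0 < x * y ^ 2 := by positivity
  have hm₀ : 0 < m ^ 2 := by positivity
  unfold Phi1 Phi2
  refine ⟨⟨?_, ?_⟩, ?_, ?_⟩ <;> linarith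
end

section
/- For i = 1,2, every integer M ≥ 1, and all real x, y with 0 < x < 1 and 0 < y < 1, one has ((1/9)·min(x,y))^(2^M) ≤ Φⁱ_M(x,y) ≤ (max(x,y))^(2^M). -/
/-- The iterates Φⁱ_N of the pair (Φ¹, Φ²): `PhiN i 0` is the i-th coordinate projection
(so that `PhiN i 1 = Φⁱ`), and `PhiN i (N+1) x y = PhiN i N (Φ¹(x,y)) (Φ²(x,y))`. -/
noncomputable def PhiN : Fin 2 → ℕ → ℝ → ℝ → ℝ
  | i, 0, x, y => if i = 0 then x else y
  | i, N+1, x, y => PhiN i N (Phi1 x y) (Phi2 x y)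

/-- λ = (20+√205)/15, the largest eigenvalue of the mean matrix. -/
noncomputable def lam : ℝ := (20 + Real.sqrt 205) / 15

/-- The Laplace transform G_N^{(i)}(t) = Φⁱ_N(exp(−λ^{−N} t), exp(−2λ^{−N} t)). -/
noncomputable def G (i : Fin 2) (N : ℕ) (t : ℝ) : ℝ :=
  PhiN i N (Real.exp (-(t / lam ^ N))) (Real.exp (-(2 * t / lam ^ N)))

/-- If `0 ≤ a ≤ x, y`, then both polynomials are at least `a ^ 2 / 9`. -/
theorem sq_div_nine_le_Phi {a x y : ℝ} (ha : 0 ≤ a) (hx : a ≤ x) (hy : a ≤ y) :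
    a ^ 2 / 9 ≤ Phi1 x y ∧ a ^ 2 / 9 ≤ Phi2 x y := by
  have hx0 := ha.trans hx
  have hy0 := ha.trans hy
  have hxx : a ^ 2 ≤ x ^ 2 := by gcongr
  have hxy : 0 ≤ x * y := by positivity
  have hyy : 0 ≤ y ^ 2 := by positivity
  have hxxx : 0 ≤ x ^ 3 := by positivity
  have hxxy : 0 ≤ x ^ 2 * y := by positivity
  have hxyy : 0 ≤ x * y ^ 2 := by positivity
  unfold Phi1 Phi2
  constructor <;> linarith [sq_nonneg a]

/-- If `0 ≤ x, y ≤ b ≤ 1`, then both polynomials are at most `b ^ 2`. -/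
theorem Phi_le_sq {b x y : ℝ} (hx0 : 0 ≤ x) (hy0 : 0 ≤ y) (hx : x ≤ b) (hy : y ≤ b)
    (hb : b ≤ 1) : Phi1 x y ≤ b ^ 2 ∧ Phi2 x y ≤ b ^ 2 := by
  have hb0 := hx0.trans hx
  have hxx : x ^ 2 ≤ b ^ 2 := by gcongr
  have hyy : y ^ 2 ≤ b ^ 2 := by gcongr
  have hxy : x * y ≤ b ^ 2 := by rw [sq]; gcongr
  have hxxx : x ^ 3 ≤ b ^ 2 := by
    nlinarith [mul_le_of_le_one_right (sq_nonneg x) (hx.trans hb)]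
  have hxxy : x ^ 2 * y ≤ b ^ 2 :=
    (mul_le_of_le_one_right (sq_nonneg x) (hy.trans hb)).trans hxx
  have hxyy : x * y ^ 2 ≤ b ^ 2 :=
    (mul_le_of_le_one_left (sq_nonneg y) (hx.trans hb)).trans hyy
  unfold Phi1 Phi2
  constructor <;> linarith

/-- Bounds on the iterates on the square `[a, b] × [a, b]` with `0 ≤ a` and `b ≤ 1`. -/
theorem PhiN_mem_Icc (i : Fin 2) (M : ℕ) {a b x y : ℝ} (ha : 0 ≤ a) (hb : b ≤ 1)
    (hx : x ∈ Set.Icc a b) (hy : y ∈ Set.Icc a b) :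
    PhiN i M x y ∈ Set.Icc ((1 / 9 * a) ^ 2 ^ M) (b ^ 2 ^ M) := by
  induction M generalizing a b x y with
  | zero =>
    obtain ⟨hax, hxb⟩ := hx
    obtain ⟨hay, hyb⟩ := hy
    simp only [PhiN, pow_zero, pow_one]
    split_ifs <;> constructor <;> linarith
  | succ N ih =>
    have hx0 := ha.trans hx.1
    have hy0 := ha.trans hy.1
    obtain ⟨hl₁, hl₂⟩ := sq_div_nine_le_Phi ha hx.1 hy.1
    obtain ⟨hu₁, hu₂⟩ := Phi_le_sq hx0 hy0 hx.2 hy.2 hb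
    have h := ih (by positivity) (pow_le_one₀ (hx0.trans hx.2) hb) ⟨hl₁, hu₁⟩ ⟨hl₂, hu₂⟩
    rw [pow_succ', pow_mul, pow_mul, show (1 / 9 * a) ^ 2 = 1 / 9 * (a ^ 2 / 9) by ring]
    exact h

/-- For i = 1,2, every integer M ≥ 1, and all real x, y with 0 < x < 1 and 0 < y < 1,
((1/9)·min(x,y))^(2^M) ≤ Φⁱ_M(x,y) ≤ (max(x,y))^(2^M). -/
theorem phiN_bounds (i : Fin 2) (M : ℕ) (hM : 1 ≤ M) (x y : ℝ)
    (hx0 : 0 < x) (hx1 : x < 1) (hy0 : 0 < y) (hy1 : y < 1) :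
    ((1/9 : ℝ) * min x y) ^ (2 ^ M) ≤ PhiN i M x y ∧
    PhiN i M x y ≤ (max x y) ^ (2 ^ M) := by
  exact PhiN_mem_Icc i M (le_min hx0.le hy0.le) (max_le hx1.le hy1.le)
    ⟨min_le_left x y, le_max_left x y⟩ ⟨min_le_right x y, le_max_right x y⟩
end

section
/- For i = 1,2, all integers N, M ≥ 1, and all real t > 0, one has ((1/9)·min(G_N^{(1)}(t/λ^M), G_N^{(2)}(t/λ^M)))^(2^M) ≤ G_{N+M}^{(i)}(t) ≤ (max(G_N^{(1)}(t/λ^M), G_N^{(2)}(t/λ^M)))^(2^M). -/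
theorem Phi1_nonneg {x y : ℝ} (hx : 0 ≤ x) (hy : 0 ≤ y) : 0 ≤ Phi1 x y := by
  unfold Phi1; positivity

theorem Phi2_nonneg {x y : ℝ} (hx : 0 ≤ x) (hy : 0 ≤ y) : 0 ≤ Phi2 x y := by
  unfold Phi2; positivity

theorem Phi1_le_sq {x y m : ℝ} (hx : 0 ≤ x) (hy : 0 ≤ y) (hxm : x ≤ m) (hym : y ≤ m)
    (hm : m ≤ 1) : Phi1 x y ≤ m ^ 2 := by
  have h0 : 0 ≤ m := hx.trans hxm
  calc Phi1 x y ≤ Phi1 m m := by unfold Phi1; gcongr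
    _ ≤ m ^ 2 := by unfold Phi1; nlinarith [mul_nonneg (sq_nonneg m) (sub_nonneg.2 hm)]

theorem Phi2_le_sq {x y m : ℝ} (hx : 0 ≤ x) (hy : 0 ≤ y) (hxm : x ≤ m) (hym : y ≤ m)
    (hm : m ≤ 1) : Phi2 x y ≤ m ^ 2 := by
  have h0 : 0 ≤ m := hx.trans hxm
  calc Phi2 x y ≤ Phi2 m m := by unfold Phi2; gcongr
    _ ≤ m ^ 2 := by unfold Phi2; nlinarith [mul_nonneg (sq_nonneg m) (sub_nonneg.2 hm)]

theorem sq_div_nine_le_Phi1 {x y m : ℝ} (hm : 0 ≤ m) (hx : m ≤ x) (hy : m ≤ y) :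
    m ^ 2 / 9 ≤ Phi1 x y := by
  calc m ^ 2 / 9 ≤ Phi1 m m := by unfold Phi1; nlinarith [sq_nonneg m, pow_nonneg hm 3]
    _ ≤ Phi1 x y := by
      have := hm.trans hx
      unfold Phi1; gcongr

theorem sq_div_nine_le_Phi2 {x y m : ℝ} (hm : 0 ≤ m) (hx : m ≤ x) (hy : m ≤ y) :
    m ^ 2 / 9 ≤ Phi2 x y := by
  calc m ^ 2 / 9 ≤ Phi2 m m := by unfold Phi2; nlinarith [sq_nonneg m, pow_nonneg hm 3]
    _ ≤ Phi2 x y := by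
      have := hm.trans hx
      unfold Phi2; gcongr

theorem PhiN_nonneg (i : Fin 2) (N : ℕ) {x y : ℝ} (hx : 0 ≤ x) (hy : 0 ≤ y) :
    0 ≤ PhiN i N x y := by
  induction N generalizing x y with
  | zero => simp only [PhiN]; split_ifs <;> assumption
  | succ N ih => exact ih (Phi1_nonneg hx hy) (Phi2_nonneg hx hy)

theorem PhiN_le_pow (i : Fin 2) (N : ℕ) {x y m : ℝ} (hx : 0 ≤ x) (hy : 0 ≤ y) (hxm : x ≤ m)
    (hym : y ≤ m) (hm : m ≤ 1) : PhiN i N x y ≤ m ^ 2 ^ N := by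
  induction N generalizing x y m with
  | zero => simp only [PhiN, pow_zero, pow_one]; split_ifs <;> assumption
  | succ N ih =>
    rw [pow_succ' 2 N, pow_mul]
    exact ih (Phi1_nonneg hx hy) (Phi2_nonneg hx hy) (Phi1_le_sq hx hy hxm hym hm)
      (Phi2_le_sq hx hy hxm hym hm) (pow_le_one₀ (hx.trans hxm) hm)

theorem pow_le_PhiN (i : Fin 2) (N : ℕ) {x y m : ℝ} (hm : 0 ≤ m) (hx : m ≤ x) (hy : m ≤ y) :
    (1 / 9 * m) ^ 2 ^ N ≤ PhiN i N x y := by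
  induction N generalizing x y m with
  | zero => simp only [PhiN, pow_zero, pow_one]; split_ifs <;> linarith
  | succ N ih =>
    rw [pow_succ' 2 N, pow_mul, show (1 / 9 * m) ^ 2 = 1 / 9 * (m ^ 2 / 9) by ring]
    exact ih (by positivity) (sq_div_nine_le_Phi1 hm hx hy) (sq_div_nine_le_Phi2 hm hx hy)

theorem PhiN_add (i : Fin 2) (N M : ℕ) (x y : ℝ) :
    PhiN i (N + M) x y = PhiN i M (PhiN 0 N x y) (PhiN 1 N x y) := by
  induction N generalizing x y with
  | zero => simp [PhiN]
  | succ N ih => rw [Nat.add_right_comm]; exact ih _ _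

theorem G_nonneg (i : Fin 2) (N : ℕ) (t : ℝ) : 0 ≤ G i N t :=
  PhiN_nonneg i N (Real.exp_nonneg _) (Real.exp_nonneg _)

theorem lam_pos : 0 < lam := by
  unfold lam; positivity

theorem G_le_one (i : Fin 2) (N : ℕ) {t : ℝ} (ht : 0 ≤ t) : G i N t ≤ 1 := by
  have hl := lam_pos
  have h := PhiN_le_pow i N (m := 1) (Real.exp_nonneg (-(t / lam ^ N)))
    (Real.exp_nonneg (-(2 * t / lam ^ N)))
    (Real.exp_le_one_iff.2 (neg_nonpos.2 (by positivity)))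
    (Real.exp_le_one_iff.2 (neg_nonpos.2 (by positivity))) le_rfl
  rwa [one_pow] at h

theorem G_add (i : Fin 2) (N M : ℕ) (t : ℝ) :
    G i (N + M) t = PhiN i M (G 0 N (t / lam ^ M)) (G 1 N (t / lam ^ M)) := by
  simp only [G, PhiN_add]
  rw [← mul_div_assoc, div_div, div_div, ← pow_add, add_comm M N]


/-- For i = 1,2, all integers N, M ≥ 1, and all real t > 0:
((1/9)·min(G_N^{(1)}(t/λ^M), G_N^{(2)}(t/λ^M)))^(2^M) ≤ G_{N+M}^{(i)}(t)
  ≤ (max(G_N^{(1)}(t/λ^M), G_N^{(2)}(t/λ^M)))^(2^M). -/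
theorem G_sandwich (i : Fin 2) (N M : ℕ) (hN : 1 ≤ N) (hM : 1 ≤ M) (t : ℝ) (ht : 0 < t) :
    ((1/9 : ℝ) * min (G 0 N (t / lam ^ M)) (G 1 N (t / lam ^ M))) ^ (2 ^ M) ≤ G i (N + M) t ∧
    G i (N + M) t ≤ (max (G 0 N (t / lam ^ M)) (G 1 N (t / lam ^ M))) ^ (2 ^ M) := by
  have hl := lam_pos
  have hs : 0 ≤ t / lam ^ M := by positivity
  rw [G_add]
  exact ⟨pow_le_PhiN i M (le_min (G_nonneg _ _ _) (G_nonneg _ _ _)) (min_le_left _ _)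
      (min_le_right _ _),
    PhiN_le_pow i M (G_nonneg _ _ _) (G_nonneg _ _ _) (le_max_left _ _) (le_max_right _ _)
      (max_le (G_le_one _ _ hs) (G_le_one _ _ hs))⟩
end

section
/- Suppose there exist positive constants C₁, C₂, C₃, C₄, a real s₀ > 0, a real s₁, and ν ∈ (0,1) such that C₁·exp(−C₂ s^ν) ≤ G_N(s) ≤ C₃·exp(−C₄ s^ν) holds for all s > s₀ and all N > s₁ + (ν/log 2)·log s. Then there exist positive constants C₇, C₈, C₉ such that for every ξ > 0 and every N ∈ ℕ satisfying (2^{1/ν − 1})^N · ξ ≥ C₇, one has μ_N([0, ξ]) ≤ C₈·exp(−C₉ ξ^{−ν/(1−ν)}). -/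
open MeasureTheory Filter

/-- Chernoff bound for the left tail on `[0, ξ]`, in terms of the Laplace transform. -/
theorem measure_Icc_le_exp_mul_laplace (μ : Measure ℝ) [IsFiniteMeasure μ] {s : ℝ} (hs : 0 ≤ s)
    (hint : Integrable (fun x => Real.exp (-(s * x))) μ) (ξ : ℝ) :
    (μ (Set.Icc 0 ξ)).toReal ≤ Real.exp (s * ξ) * ∫ x, Real.exp (-(s * x)) ∂μ := by
  have h := ProbabilityTheory.measure_le_le_exp_mul_mgf (μ := μ) (X := fun x => x) ξ
    (neg_nonpos.mpr hs) (by simpa only [neg_mul] using hint)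
  simp only [ProbabilityTheory.mgf, neg_mul, neg_neg] at h
  exact (measureReal_mono fun x hx => hx.2).trans h

/-- Exponential Tauberian theorem (left tail, uniform estimate): if the Laplace
transforms G_N(s) = ∫ e^{−sx} μ_N(dx) of a family of probability measures μ_N on [0,∞)
satisfy C₁·exp(−C₂ s^ν) ≤ G_N(s) ≤ C₃·exp(−C₄ s^ν) for all s > s₀ and all
N > s₁ + (ν/log 2)·log s, then there exist C₇, C₈, C₉ > 0 such that for every ξ > 0
and every N with (2^{1/ν − 1})^N · ξ ≥ C₇ one has
μ_N([0, ξ]) ≤ C₈·exp(−C₉ ξ^{−ν/(1−ν)}). -/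
theorem tauberian_uniform_estimate
    (μ : ℕ → Measure ℝ) (hprob : ∀ N, IsProbabilityMeasure (μ N))
    (hsupp : ∀ N, μ N (Set.Iio 0) = 0)
    (ν : ℝ) (hν0 : 0 < ν) (hν1 : ν < 1)
    (C₁ C₂ C₃ C₄ s₀ s₁ : ℝ)
    (hC₁ : 0 < C₁) (hC₂ : 0 < C₂) (hC₃ : 0 < C₃) (hC₄ : 0 < C₄) (hs₀ : 0 < s₀)
    (hG : ∀ s : ℝ, s₀ < s → ∀ N : ℕ, s₁ + ν / Real.log 2 * Real.log s < (N : ℝ) →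
      C₁ * Real.exp (-(C₂ * s ^ ν)) ≤ ∫ x, Real.exp (-(s * x)) ∂(μ N) ∧
      (∫ x, Real.exp (-(s * x)) ∂(μ N)) ≤ C₃ * Real.exp (-(C₄ * s ^ ν))) :
    ∃ C₇ > (0:ℝ), ∃ C₈ > (0:ℝ), ∃ C₉ > (0:ℝ),
      ∀ ξ : ℝ, 0 < ξ → ∀ N : ℕ, C₇ ≤ ((2:ℝ) ^ (1/ν - 1)) ^ N * ξ →
        (μ N (Set.Icc 0 ξ)).toReal ≤ C₈ * Real.exp (-(C₉ * ξ ^ (-(ν / (1 - ν))))) := by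
  have hν : 0 < 1 - ν := by linarith
  have hlog2 : 0 < Real.log 2 := Real.log_pos one_lt_two
  set a : ℝ := (C₄ / 2) ^ (1 / (1 - ν)) with ha_def
  have ha : 0 < a := by positivity
  have haC : C₄ * a ^ ν = 2 * a := by
    have h1 : a ^ (1 - ν) = C₄ / 2 := by
      rw [ha_def, ← Real.rpow_mul (by positivity), one_div_mul_cancel hν.ne', Real.rpow_one]
    have h2 : a ^ (1 - ν) * a ^ ν = a := by
      rw [← Real.rpow_add ha, sub_add_cancel, Real.rpow_one]
    rw [h1] at h2
    linarith
  refine ⟨Real.exp ((s₁ + ν / Real.log 2 * Real.log a + 1) * ((1 - ν) * Real.log 2 / ν)),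
    Real.exp_pos _, C₃ + Real.exp (C₄ * s₀ ^ ν), by positivity, a, ha, fun ξ hξ N hN => ?_⟩
  have := hprob N
  -- The parameter at which the Chernoff exponent is a negative multiple of `ξ ^ (-ν / (1 - ν))`.
  set s : ℝ := a * ξ ^ (-(1 / (1 - ν))) with hs_def
  set e : ℝ := ξ ^ (-(ν / (1 - ν))) with he_def
  have hs : 0 < s := by positivity
  have he : 0 < e := by positivity
  have hsξ : s * ξ = a * e := by
    have : ξ ^ (-(1 / (1 - ν))) * ξ = e := by
      rw [he_def, ← Real.rpow_add_one hξ.ne']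
      congr 1
      field_simp
      ring
    rw [hs_def, mul_assoc, this]
  have hsν : C₄ * s ^ ν = 2 * a * e := by
    have : (ξ ^ (-(1 / (1 - ν)))) ^ ν = e := by
      rw [he_def, ← Real.rpow_mul hξ.le]
      congr 1
      field_simp
    rw [hs_def, Real.mul_rpow ha.le (by positivity), this, ← mul_assoc, haC]
  rcases le_or_gt s s₀ with hle | hlt
  · have hbd : a * e ≤ C₄ * s₀ ^ ν := by
      have : C₄ * s ^ ν ≤ C₄ * s₀ ^ ν := by gcongr
      nlinarith [mul_pos ha he]
    calc (μ N (Set.Icc 0 ξ)).toReal ≤ 1 := measureReal_le_one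
      _ ≤ Real.exp (C₄ * s₀ ^ ν) * Real.exp (-(a * e)) := by
        rw [← Real.exp_add]
        exact Real.one_le_exp (by linarith)
      _ ≤ _ := by gcongr; linarith
  · have hlogs : Real.log s = Real.log a - Real.log ξ / (1 - ν) := by
      rw [hs_def, Real.log_mul ha.ne' (by positivity), Real.log_rpow hξ]
      ring
    have hNs : s₁ + ν / Real.log 2 * Real.log s < (N : ℝ) := by
      have h := Real.log_le_log (Real.exp_pos _) hN
      rw [Real.log_exp, Real.log_mul (by positivity) hξ.ne', Real.log_pow,
        Real.log_rpow two_pos] at h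
      have h' := mul_le_mul_of_nonneg_right h
        (show 0 ≤ ν / ((1 - ν) * Real.log 2) by positivity)
      have hl : (s₁ + ν / Real.log 2 * Real.log a + 1) * ((1 - ν) * Real.log 2 / ν) *
          (ν / ((1 - ν) * Real.log 2)) = s₁ + ν / Real.log 2 * Real.log a + 1 := by
        field_simp
      have hr : (N * ((1 / ν - 1) * Real.log 2) + Real.log ξ) * (ν / ((1 - ν) * Real.log 2)) =
          N + ν / Real.log 2 * (Real.log ξ / (1 - ν)) := by
        field_simp
      rw [hl, hr] at h'
      rw [hlogs, mul_sub]
      linarith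
    obtain ⟨hlow, hup⟩ := hG s hlt N hNs
    have hint : Integrable (fun x => Real.exp (-(s * x))) (μ N) :=
      Integrable.of_integral_ne_zero (lt_of_lt_of_le (by positivity) hlow).ne'
    calc (μ N (Set.Icc 0 ξ)).toReal
        ≤ Real.exp (s * ξ) * ∫ x, Real.exp (-(s * x)) ∂(μ N) :=
          measure_Icc_le_exp_mul_laplace (μ N) hs.le hint ξ
      _ ≤ Real.exp (s * ξ) * (C₃ * Real.exp (-(C₄ * s ^ ν))) := by gcongr
      _ = C₃ * Real.exp (-(a * e)) := by
        rw [hsξ, hsν, mul_left_comm, ← Real.exp_add]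
        ring_nf
      _ ≤ _ := by gcongr; linarith [Real.exp_pos (C₄ * s₀ ^ ν)]
end

section
/- Let B₁, B₂, … be a sequence of events in a probability space such that for all m, k ∈ ℕ the conditional probability of B_m given B_{m+1}^c ∩ B_{m+2}^c ∩ ⋯ ∩ B_{m+k}^c equals the conditional probability of B_m given B_{m+1}^c (all conditioning events being assumed to have positive probability). If Σ_{m=1}^∞ P[B_m | B_{m+1}^c] = ∞, then P[limsup_{m→∞} B_m] = 1. -/
open MeasureTheory Filter

/-- If `T k m` are nonnegative reals with `T (k + 2) m = (1 - q m) * T (k + 1) (m + 1)`, then they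
decay at least exponentially in the partial sums of `q`. -/
lemma le_exp_neg_sum_of_backward_recursion {T : ℕ → ℕ → ℝ} {q : ℕ → ℝ}
    (hT0 : ∀ k m, 0 ≤ T k m) (hT1 : ∀ k m, T k m ≤ 1)
    (hrec : ∀ k m, T (k + 2) m = (1 - q m) * T (k + 1) (m + 1)) (k m : ℕ) :
    T (k + 1) m ≤ Real.exp (-∑ i ∈ Finset.range k, q (m + i)) := by
  induction k generalizing m with
  | zero => simpa using hT1 1 m
  | succ k ih =>
    have hsum : -∑ i ∈ Finset.range (k + 1), q (m + i)
        = -q m + -∑ i ∈ Finset.range k, q (m + 1 + i) := by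
      rw [Finset.sum_range_succ', Finset.sum_congr rfl fun i _ ↦ by
        rw [show m + (i + 1) = m + 1 + i by ring]]
      simp only [add_zero]
      ring
    rw [hrec k m, hsum, Real.exp_add]
    have h1 : 1 - q m ≤ Real.exp (-q m) := Real.one_sub_le_exp_neg _
    exact mul_le_mul h1 (ih (m + 1)) (hT0 _ _) (Real.exp_pos _).le

/-- A version of the second Borel–Cantelli lemma: let B₁, B₂, … be events such that
for all m, k ≥ 1, P[B_m | B_{m+1}ᶜ ∩ ⋯ ∩ B_{m+k}ᶜ] = P[B_m | B_{m+1}ᶜ], all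
conditioning events having positive probability. If Σ_{m≥1} P[B_m | B_{m+1}ᶜ] = ∞,
then P[limsup B_m] = 1. (Conditional probabilities are ratios in ℝ≥0∞.) -/
theorem borel_cantelli_conditional
    {Ω : Type*} [MeasurableSpace Ω] (P : Measure Ω) [IsProbabilityMeasure P]
    (B : ℕ → Set Ω) (hmeas : ∀ m, MeasurableSet (B m))
    (hpos : ∀ m k : ℕ, 1 ≤ m → 1 ≤ k →
      0 < P (⋂ j ∈ Finset.Icc (m + 1) (m + k), (B j)ᶜ))
    (hcond : ∀ m k : ℕ, 1 ≤ m → 1 ≤ k →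
      P (B m ∩ ⋂ j ∈ Finset.Icc (m + 1) (m + k), (B j)ᶜ) /
          P (⋂ j ∈ Finset.Icc (m + 1) (m + k), (B j)ᶜ)
        = P (B m ∩ (B (m + 1))ᶜ) / P ((B (m + 1))ᶜ))
    (hdiv : ∑' m : ℕ, P (B (m + 1) ∩ (B (m + 2))ᶜ) / P ((B (m + 2))ᶜ) = ⊤) :
    P (Filter.limsup B Filter.atTop) = 1 := by
  set r : ℕ → ENNReal := fun m ↦ P (B (m + 1) ∩ (B (m + 2))ᶜ) / P ((B (m + 2))ᶜ) with hr
  set C : ℕ → ℕ → Set Ω := fun k m ↦ ⋂ j ∈ Finset.Icc (m + 1) (m + k), (B j)ᶜ with hC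
  have hr_top (m : ℕ) : r m ≠ ⊤ := by
    have h := hpos (m + 1) 1 (by omega) le_rfl
    simp only [Finset.Icc_self, Finset.mem_singleton, Set.iInter_iInter_eq_left] at h
    exact ENNReal.div_ne_top (measure_ne_top _ _) h.ne'
  have hrec (k m : ℕ) :
      P.real (C (k + 2) m) = (1 - (r m).toReal) * P.real (C (k + 1) (m + 1)) := by
    have hset : C (k + 2) m = C (k + 1) (m + 1) \ B (m + 1) := by
      have hI : Finset.Icc (m + 1) (m + (k + 2))
          = insert (m + 1) (Finset.Icc (m + 1 + 1) (m + 1 + (k + 1))) := by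
        ext j
        simp only [Finset.mem_Icc, Finset.mem_insert]
        omega
      simp only [hC]
      rw [hI, Finset.set_biInter_insert, Set.inter_comm, Set.sdiff_eq]
    have hp : P.real (B (m + 1) ∩ C (k + 1) (m + 1)) / P.real (C (k + 1) (m + 1))
        = (r m).toReal := by
      have h := congrArg ENNReal.toReal (hcond (m + 1) (k + 1) (by omega) (by omega))
      rwa [ENNReal.toReal_div] at h
    have hne : P.real (C (k + 1) (m + 1)) ≠ 0 :=
      (ENNReal.toReal_pos (hpos (m + 1) (k + 1) (by omega) (by omega)).ne'
        (measure_ne_top _ _)).ne'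
    have hadd := measureReal_sdiff_add_inter (μ := P) (s := C (k + 1) (m + 1)) (hmeas (m + 1))
    rw [Set.inter_comm] at hadd
    rw [div_eq_iff hne] at hp
    rw [hset]
    linarith
  have hbound := le_exp_neg_sum_of_backward_recursion (T := fun k m ↦ P.real (C k m))
    (q := fun m ↦ (r m).toReal) (fun _ _ ↦ measureReal_nonneg) (fun _ _ ↦ measureReal_le_one) hrec
  have hns : ¬ Summable fun m ↦ (r m).toReal := fun hs ↦ by
    apply hs.tsum_ofReal_ne_top
    simpa only [ENNReal.ofReal_toReal (hr_top _)] using hdiv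
  have hnull (m : ℕ) : P (⋂ j ≥ m + 1, (B j)ᶜ) = 0 := by
    rw [← measureReal_eq_zero_iff]
    refine le_antisymm ?_ measureReal_nonneg
    have hns' : ¬ Summable fun i ↦ (r (m + i)).toReal := by
      simpa only [add_comm m] using (summable_nat_add_iff m).not.mpr hns
    have ht := (not_summable_iff_tendsto_nat_atTop_of_nonneg
      fun i ↦ ENNReal.toReal_nonneg).mp hns'
    refine ge_of_tendsto' (Real.tendsto_exp_neg_atTop_nhds_zero.comp ht) fun k ↦ ?_
    refine (measureReal_mono ?_).trans (hbound k m)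
    refine Set.iInter₂_mono' fun j hj ↦ ⟨j, (Finset.mem_Icc.mp hj).1, subset_rfl⟩
  rw [← prob_compl_eq_zero_iff (MeasurableSet.measurableSet_limsup hmeas)]
  refine measure_mono_null ?_ (measure_iUnion_null hnull)
  intro x hx
  rw [Set.mem_compl_iff, mem_limsup_iff_frequently_mem, not_frequently,
    eventually_atTop] at hx
  obtain ⟨a, ha⟩ := hx
  exact Set.mem_iUnion.mpr ⟨a, Set.mem_iInter₂.mpr fun j hj ↦ ha j ((Nat.le_succ a).trans hj)⟩
end

section
/- For every probability vector a ∈ ℝ⁴ (i.e., a has nonnegative entries summing to 1), the sequence of row vectors a·Pⁿ converges as n → ∞ to α = (1/28)·(11, 11, 3, 3). -/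
/-- The transition probability matrix P of the backward Markov chain. -/
noncomputable def Pmat : Matrix (Fin 4) (Fin 4) ℝ :=
  (1 / 30 : ℝ) • !![19, 5, 5, 1; 5, 19, 1, 5; 7, 15, 5, 3; 15, 7, 3, 5]

/-- The invariant row vector α = (1/28)·(11, 11, 3, 3). -/
noncomputable def alphaVec : Fin 4 → ℝ := ![11/28, 11/28, 3/28, 3/28]

/-- A left eigenvector of `M` is a left eigenvector of every power of `M`. -/
theorem Matrix.vecMul_pow_of_vecMul_eq_smul {ι R : Type*} [Fintype ι] [DecidableEq ι]
    [CommSemiring R] {M : Matrix ι ι R} {v : ι → R} {c : R} (h : Matrix.vecMul v M = c • v)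
    (n : ℕ) : Matrix.vecMul v (M ^ n) = c ^ n • v := by
  induction n with
  | zero => simp
  | succ n ih =>
    rw [pow_succ, ← Matrix.vecMul_vecMul, ih, Matrix.smul_vecMul, h, smul_smul, pow_succ]

theorem vecMul_alphaVec_Pmat : Matrix.vecMul alphaVec Pmat = (1 : ℝ) • alphaVec := by
  ext i
  fin_cases i <;>
    simp [alphaVec, Pmat, Matrix.vecMul, dotProduct, Fin.sum_univ_four] <;> norm_num

theorem vecMul_Pmat_eigenvector_third :
    Matrix.vecMul ![2, -2, 1, -1] Pmat = (1 / 3 : ℝ) • ![2, -2, 1, -1] := by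
  ext i
  fin_cases i <;> simp [Pmat, Matrix.vecMul, dotProduct, Fin.sum_univ_four] <;> norm_num

theorem vecMul_Pmat_eigenvector_fifth :
    Matrix.vecMul ![1, -1, 1, -1] Pmat = (1 / 5 : ℝ) • ![1, -1, 1, -1] := by
  ext i
  fin_cases i <;> simp [Pmat, Matrix.vecMul, dotProduct, Fin.sum_univ_four] <;> norm_num

theorem vecMul_Pmat_eigenvector_fifteenth :
    Matrix.vecMul ![1, 1, -1, -1] Pmat = (1 / 15 : ℝ) • ![1, 1, -1, -1] := by
  ext i
  fin_cases i <;> simp [Pmat, Matrix.vecMul, dotProduct, Fin.sum_univ_four] <;> norm_num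

/-- Decomposition of a vector of total mass one along left eigenvectors of `Pmat`. -/
theorem eq_alphaVec_add_eigenvectors {a : Fin 4 → ℝ} (hsum : ∑ i, a i = 1) :
    a = alphaVec + ((a 0 - a 1 - a 2 + a 3) / 2) • ![2, -2, 1, -1]
      + (-(a 0 - a 1 - 2 * a 2 + 2 * a 3) / 2) • ![1, -1, 1, -1]
      + (-(a 2 + a 3 - 3 / 14) / 2) • ![1, 1, -1, -1] := by
  rw [Fin.sum_univ_four] at hsum
  ext i
  fin_cases i <;> simp [alphaVec] <;> linarith

/-- For every probability vector a ∈ ℝ⁴, a·Pⁿ converges to α = (1/28)·(11,11,3,3)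
as n → ∞. -/
theorem vecMul_pow_tendsto_alphaVec
    (a : Fin 4 → ℝ) (ha : ∀ i, 0 ≤ a i) (hsum : ∑ i, a i = 1) :
    Filter.Tendsto (fun n : ℕ => Matrix.vecMul a (Pmat ^ n))
      Filter.atTop (nhds alphaVec) := by
  have decay (c k : ℝ) (h₀ : 0 ≤ c) (h₁ : c < 1) (v : Fin 4 → ℝ) :
      Filter.Tendsto (fun n : ℕ => k • c ^ n • v) Filter.atTop (nhds 0) := by
    simpa using ((tendsto_pow_atTop_nhds_zero_of_lt_one h₀ h₁).smul_const v).const_smul k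
  rw [eq_alphaVec_add_eigenvectors hsum]
  simp only [Matrix.add_vecMul, Matrix.smul_vecMul,
    Matrix.vecMul_pow_of_vecMul_eq_smul vecMul_alphaVec_Pmat,
    Matrix.vecMul_pow_of_vecMul_eq_smul vecMul_Pmat_eigenvector_third,
    Matrix.vecMul_pow_of_vecMul_eq_smul vecMul_Pmat_eigenvector_fifth,
    Matrix.vecMul_pow_of_vecMul_eq_smul vecMul_Pmat_eigenvector_fifteenth, one_pow, one_smul]
  simpa only [add_zero] using ((tendsto_const_nhds.add
    (decay (1 / 3) _ (by norm_num) (by norm_num) _)).add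
    (decay (1 / 5) _ (by norm_num) (by norm_num) _)).add
    (decay (1 / 15) _ (by norm_num) (by norm_num) _)
end

section
/- There exist entire functions g₁, g₂ : ℂ → ℂ with g₁(0) = g₂(0) = 1 such that for i = 1,2 the sequence of entire functions G_N^{(i)} converges to g_i uniformly on every compact subset of ℂ as N → ∞, and the limits satisfy the functional equations g₁(λt) = Φ¹(g₁(t), g₂(t)) and g₂(λt) = Φ²(g₁(t), g₂(t)) for all t ∈ ℂ. -/
/-- The generating-function polynomial Φ¹ as a map ℂ² → ℂ. -/
noncomputable def Phi1C (x y : ℂ) : ℂ :=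
  (15*x^2 + 8*x*y + y^2 + 2*x^2*y + 4*x^3) / 30

/-- The generating-function polynomial Φ² as a map ℂ² → ℂ. -/
noncomputable def Phi2C (x y : ℂ) : ℂ :=
  (5*x^2 + 11*x*y + 2*y^2 + 14*x^2*y + 8*x^3 + 5*x*y^2) / 45

/-- The iterates Φⁱ_N of the pair (Φ¹, Φ²) over ℂ: `PhiNC i 0` is the i-th coordinate
projection (so that `PhiNC i 1 = Φⁱ`), and
`PhiNC i (N+1) x y = PhiNC i N (Φ¹(x,y)) (Φ²(x,y))`. -/
noncomputable def PhiNC : Fin 2 → ℕ → ℂ → ℂ → ℂ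
  | i, 0, x, y => if i = 0 then x else y
  | i, N+1, x, y => PhiNC i N (Phi1C x y) (Phi2C x y)

/-- G_N^{(i)}(t) = Φⁱ_N(exp(−λ^{−N} t), exp(−2λ^{−N} t)) as an entire function of t ∈ ℂ. -/
noncomputable def GC (i : Fin 2) (N : ℕ) (t : ℂ) : ℂ :=
  PhiNC i N (Complex.exp (-(t / (lam : ℂ) ^ N))) (Complex.exp (-(2 * t / (lam : ℂ) ^ N)))

open Filter Topology

theorem eventually_mul_le_nhdsGT_zero (A : ℝ) {D : ℝ} (hD : 0 < D) :
    ∀ᶠ r in 𝓝[>] (0 : ℝ), A * r ≤ D := by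
  have : Tendsto (fun r : ℝ => A * r) (𝓝[>] 0) (𝓝 (A * 0)) :=
    ((continuous_const.mul continuous_id).tendsto 0).mono_left nhdsWithin_le_nhds
  rw [mul_zero] at this
  exact this.eventually_le_const hD

/-- A rescaling preimage of a point under an expanding linear map. -/
theorem exists_eq_mul_norm_le {Λ : ℂ} (hΛ : 1 < ‖Λ‖) (t : ℂ) :
    ∃ s, t = Λ * s ∧ ‖t‖ = ‖Λ‖ * ‖s‖ ∧ ‖s‖ ≤ ‖t‖ := by
  have hΛ0 : Λ ≠ 0 := norm_pos_iff.1 (one_pos.trans hΛ)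
  have hl : ‖Λ‖ ≠ 0 := norm_ne_zero_iff.2 hΛ0
  refine ⟨t / Λ, by field_simp, ?_, ?_⟩
  · rw [norm_div]
    field_simp
  · rw [norm_div]
    exact div_le_self (norm_nonneg _) hΛ.le

/-- Suppose `h (N + 1) (Λ t) = (Λ a, μ b) + q (a, b)` with `(a, b) = h N t`, where `q` vanishes to
second order at the origin. Then `h N` is `O(t)` near the origin, uniformly in `N`. -/
theorem exists_norm_le_of_rescaling {Λ μ : ℂ} {C ρ R r₀ : ℝ} {h : ℕ → ℂ → ℂ × ℂ}
    {q : ℂ × ℂ → ℂ × ℂ} (hΛ : 1 < ‖Λ‖) (hμ : ‖μ‖ ≤ ‖Λ‖)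
    (hC : 0 < C) (hρ : 0 < ρ) (hR : 0 < R) (hr₀ : 0 < r₀) (hq0 : q 0 = 0)
    (hq : ∀ m z w, m ≤ ρ → ‖z‖ ≤ m → ‖w‖ ≤ m → ‖q z - q w‖ ≤ C * m * ‖z - w‖)
    (hrec : ∀ N t, h (N + 1) (Λ * t) = (Λ * (h N t).1, μ * (h N t).2) + q (h N t))
    (h0 : ∀ t, ‖t‖ ≤ r₀ → ‖h 0 t‖ ≤ R * ‖t‖) :
    ∃ r > 0, ∀ N t, ‖t‖ ≤ r → ‖h N t‖ ≤ 2 * R * ‖t‖ := by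
  set l := ‖Λ‖ with hl
  obtain ⟨S, hS, hSC⟩ : ∃ S : ℝ, 0 < S ∧ C * (2 * R) ^ 2 ≤ (l ^ 2 - l) * S := by
    have : 0 < l ^ 2 - l := by nlinarith
    refine ⟨C * (2 * R) ^ 2 / (l ^ 2 - l), by positivity, ?_⟩
    exact (mul_div_cancel₀ _ this.ne').ge
  obtain ⟨r, hr, hrr₀, hSr, hRr⟩ : ∃ r > 0, r ≤ r₀ ∧ S * r ≤ R ∧ 2 * R * r ≤ ρ := by
    obtain ⟨r, h1, h2, h3, h4⟩ := ((eventually_mem_nhdsWithin (a := (0 : ℝ))).and <|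
      (eventually_mul_le_nhdsGT_zero 1 hr₀).and <| (eventually_mul_le_nhdsGT_zero S hR).and <|
      eventually_mul_le_nhdsGT_zero (2 * R) hρ).exists
    exact ⟨r, h1, by simpa using h2, h3, h4⟩
  have bound : ∀ N t, ‖t‖ ≤ r → ‖h N t‖ ≤ R * ‖t‖ + S * ‖t‖ ^ 2 := by
    intro N
    induction N with
    | zero =>
      intro t ht
      have := h0 t (ht.trans hrr₀)
      nlinarith [sq_nonneg ‖t‖]
    | succ N ih =>
      intro t ht
      obtain ⟨s, rfl, hts, hst⟩ := exists_eq_mul_norm_le hΛ t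
      have hsr := hst.trans ht
      have hb := ih s hsr
      have hs0 := norm_nonneg s
      have hSs : S * ‖s‖ ≤ R := (mul_le_mul_of_nonneg_left hsr hS.le).trans hSr
      have hb2 : ‖h N s‖ ≤ 2 * R * ‖s‖ := by nlinarith
      have hqb : ‖q (h N s)‖ ≤ C * (2 * R * ‖s‖) * (2 * R * ‖s‖) := by
        have := hq (2 * R * ‖s‖) (h N s) 0 (by nlinarith) hb2 (by
          rw [norm_zero]
          positivity)
        rw [hq0, sub_zero, sub_zero] at this
        exact this.trans (by gcongr)
      have hlin : ‖((Λ * (h N s).1, μ * (h N s).2) : ℂ × ℂ)‖ ≤ l * ‖h N s‖ := by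
        rw [Prod.norm_mk, norm_mul, norm_mul]
        refine max_le ?_ ?_
        · gcongr
          exact norm_fst_le _
        · gcongr
          exact norm_snd_le _
      rw [hrec, hts]
      refine (norm_add_le _ _).trans ?_
      have := mul_le_mul_of_nonneg_left hb (by positivity : 0 ≤ l)
      nlinarith [mul_le_mul_of_nonneg_right hSC (sq_nonneg ‖s‖)]
  refine ⟨r, hr, fun N t ht => (bound N t ht).trans ?_⟩
  have hSt : S * ‖t‖ ≤ R := (mul_le_mul_of_nonneg_left ht hS.le).trans hSr
  nlinarith [norm_nonneg t]

/-- Under the hypotheses of `exists_norm_le_of_rescaling`, if the first coordinate of `h 0` is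
`c t + O(t²)`, then consecutive terms of `h` get geometrically close on some disc around the
origin. -/
theorem exists_norm_succ_sub_le_geometric {Λ μ c : ℂ} {κ C ρ R r₀ : ℝ} {h : ℕ → ℂ → ℂ × ℂ}
    {q : ℂ × ℂ → ℂ × ℂ} (hΛ : 1 < ‖Λ‖) (hμ : ‖μ‖ ≤ ‖Λ‖) (hκ : 0 < κ)
    (hκΛ : 1 < κ * ‖Λ‖) (hκμ : ‖μ‖ < κ * ‖Λ‖)
    (hC : 0 < C) (hρ : 0 < ρ) (hR : 0 < R) (hr₀ : 0 < r₀) (hq0 : q 0 = 0)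
    (hq : ∀ m z w, m ≤ ρ → ‖z‖ ≤ m → ‖w‖ ≤ m → ‖q z - q w‖ ≤ C * m * ‖z - w‖)
    (hrec : ∀ N t, h (N + 1) (Λ * t) = (Λ * (h N t).1, μ * (h N t).2) + q (h N t))
    (h0 : ∀ t, ‖t‖ ≤ r₀ → ‖h 0 t‖ ≤ R * ‖t‖)
    (h0' : ∀ t, ‖t‖ ≤ r₀ → ‖(h 0 t).1 - c * t‖ ≤ R * ‖t‖ ^ 2) :
    ∃ r > 0, ∃ M, ∀ N t, ‖t‖ ≤ r → ‖h (N + 1) t - h N t‖ ≤ M * κ ^ N := by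
  set l := ‖Λ‖ with hl
  set B := 2 * R + C * R ^ 2 with hB
  have hB0 : 0 < B := by positivity
  have hgap : 0 < κ * l ^ 2 - l := by nlinarith [mul_pos (one_pos.trans hΛ) (sub_pos.2 hκΛ)]
  have hgap' : 0 < κ * l - ‖μ‖ := by linarith
  obtain ⟨M, hMB, hM⟩ : ∃ M, B ≤ M ∧ C * (2 * R) * B ≤ M * ((κ * l ^ 2 - l) / 2) := by
    refine ⟨max B (C * (2 * R) * B / ((κ * l ^ 2 - l) / 2)), le_max_left _ _, ?_⟩
    rw [← div_le_iff₀ (by positivity)]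
    exact le_max_right _ _
  have hM0 : 0 < M := hB0.trans_le hMB
  obtain ⟨r₁, hr₁, bound'⟩ := exists_norm_le_of_rescaling hΛ hμ hC hρ hR hr₀ hq0 hq hrec h0
  obtain ⟨r, hr, hr1, hrr₀, hrr₁, hRr, hCr, hBr⟩ : ∃ r > 0, r ≤ 1 ∧ r ≤ r₀ ∧ r ≤ r₁ ∧
      2 * R * r ≤ ρ ∧ C * (2 * R) * r ≤ (κ * l ^ 2 - l) / 2 ∧
      C * (2 * R) * (M + B) * r ≤ B * (κ * l - ‖μ‖) := by
    obtain ⟨r, h1, h2, h3, h4, h5, h6, h7⟩ := ((eventually_mem_nhdsWithin (a := (0 : ℝ))).and <|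
      (eventually_mul_le_nhdsGT_zero 1 one_pos).and <|
      (eventually_mul_le_nhdsGT_zero 1 hr₀).and <|
      (eventually_mul_le_nhdsGT_zero 1 hr₁).and <|
      (eventually_mul_le_nhdsGT_zero (2 * R) hρ).and <|
      (eventually_mul_le_nhdsGT_zero (C * (2 * R)) (half_pos hgap)).and <|
      eventually_mul_le_nhdsGT_zero (C * (2 * R) * (M + B)) (mul_pos hB0 hgap')).exists
    exact ⟨r, h1, by simpa using h2, by simpa using h3, by simpa using h4, h5, h6, h7⟩
  replace bound' : ∀ N t, ‖t‖ ≤ r → ‖h N t‖ ≤ 2 * R * ‖t‖ := fun N t ht =>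
    bound' N t (ht.trans hrr₁)
  have hρs : ∀ s : ℂ, ‖s‖ ≤ r → 2 * R * ‖s‖ ≤ ρ := fun s hs =>
    (mul_le_mul_of_nonneg_left hs (by positivity)).trans hRr
  have diff : ∀ N t, ‖t‖ ≤ r → ‖(h (N + 1) t).1 - (h N t).1‖ ≤ M * κ ^ N * ‖t‖ ^ 2 ∧
      ‖(h (N + 1) t).2 - (h N t).2‖ ≤ B * κ ^ N * ‖t‖ := by
    intro N
    induction N with
    | zero =>
      intro t ht
      obtain ⟨s, rfl, hts, hst⟩ := exists_eq_mul_norm_le hΛ t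
      have hs0 := norm_nonneg s
      have hsr := hst.trans ht
      have hb := h0 s (hsr.trans hrr₀)
      have hqb : ‖q (h 0 s)‖ ≤ C * (R * ‖s‖) * (R * ‖s‖) := by
        have := hq (R * ‖s‖) (h 0 s) 0 (by linarith [hρs s hsr, mul_nonneg hR.le hs0]) hb (by
          rw [norm_zero]
          positivity)
        rw [hq0, sub_zero, sub_zero] at this
        exact this.trans (by gcongr)
      have hqt : ‖q (h 0 s)‖ ≤ C * R ^ 2 * ‖Λ * s‖ ^ 2 := by
        calc _ ≤ C * R ^ 2 * ‖s‖ ^ 2 := by linarith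
          _ ≤ _ := by gcongr
      have ht1 : ‖Λ * s‖ ≤ 1 := ht.trans hr1
      rw [hrec]
      constructor
      · have e1 := h0' s (hsr.trans hrr₀)
        have e2 := h0' (Λ * s) (ht.trans hrr₀)
        have e3 : ((Λ * (h 0 s).1, μ * (h 0 s).2) + q (h 0 s)).1 - (h 0 (Λ * s)).1 =
          Λ * ((h 0 s).1 - c * s) + (q (h 0 s)).1 - ((h 0 (Λ * s)).1 - c * (Λ * s)) := by
          simp only [Prod.fst_add]
          ring
        rw [e3]
        have e4 : ‖Λ * ((h 0 s).1 - c * s)‖ ≤ R * ‖Λ * s‖ ^ 2 := by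
          rw [norm_mul, hts, ← hl]
          have := mul_le_mul_of_nonneg_left e1 (by positivity : 0 ≤ l)
          calc _ ≤ l * (R * ‖s‖ ^ 2) := this
            _ ≤ l ^ 2 * (R * ‖s‖ ^ 2) := by
              gcongr
              exact le_self_pow₀ hΛ.le two_ne_zero
            _ = _ := by ring
        have e5 := (norm_fst_le (q (h 0 s))).trans hqt
        have e6 := (norm_sub_le (Λ * ((h 0 s).1 - c * s) + (q (h 0 s)).1)
          ((h 0 (Λ * s)).1 - c * (Λ * s))).trans (add_le_add_left (norm_add_le _ _) _)
        have e7 := mul_le_mul_of_nonneg_right hMB (sq_nonneg ‖Λ * s‖)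
        simp only [pow_zero, mul_one]
        rw [hB] at e7
        linarith
      · have e1 := (norm_snd_le (h 0 s)).trans hb
        have e2 := (norm_snd_le _).trans (h0 (Λ * s) (ht.trans hrr₀))
        have e4 : ‖μ * (h 0 s).2‖ ≤ R * ‖Λ * s‖ := by
          rw [norm_mul, hts]
          calc _ ≤ l * (R * ‖s‖) := by gcongr
            _ = _ := by ring
        have e5 : ‖(q (h 0 s)).2‖ ≤ C * R ^ 2 * ‖Λ * s‖ := by
          refine ((norm_snd_le _).trans hqt).trans ?_
          gcongr
          exact pow_le_of_le_one (norm_nonneg _) ht1 two_ne_zero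
        have e6 := (norm_sub_le (μ * (h 0 s).2 + (q (h 0 s)).2)
          (h 0 (Λ * s)).2).trans (add_le_add_left (norm_add_le _ _) _)
        simp only [pow_zero, mul_one, Prod.snd_add]
        rw [hB]
        linarith
    | succ N ih =>
      intro t ht
      obtain ⟨s, rfl, hts, hst⟩ := exists_eq_mul_norm_le hΛ t
      have hs0 := norm_nonneg s
      have hsr := hst.trans ht
      obtain ⟨i1, i2⟩ := ih s hsr
      have hk : 0 < κ ^ N := by positivity
      have hd : ‖h (N + 1) s - h N s‖ ≤ M * κ ^ N * ‖s‖ ^ 2 + B * κ ^ N * ‖s‖ := by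
        rw [Prod.norm_def]
        refine max_le (i1.trans ?_) (i2.trans ?_)
        · exact le_add_of_nonneg_right (by positivity)
        · exact le_add_of_nonneg_left (by positivity)
      have hqd : ‖q (h (N + 1) s) - q (h N s)‖ ≤
          C * (2 * R * ‖s‖) * (M * κ ^ N * ‖s‖ ^ 2 + B * κ ^ N * ‖s‖) := by
        refine (hq (2 * R * ‖s‖) _ _ (hρs s hsr) (bound' _ _ hsr) (bound' _ _ hsr)).trans ?_
        gcongr
      rw [hrec, hrec]
      constructor
      · have e3 : ((Λ * (h (N + 1) s).1, μ * (h (N + 1) s).2) + q (h (N + 1) s)).1 -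
            ((Λ * (h N s).1, μ * (h N s).2) + q (h N s)).1 =
            Λ * ((h (N + 1) s).1 - (h N s).1) + (q (h (N + 1) s) - q (h N s)).1 := by
          simp only [Prod.fst_add, Prod.fst_sub]
          ring
        rw [e3, hts]
        refine (norm_add_le _ _).trans ?_
        rw [norm_mul, ← hl]
        calc _ ≤ l * (M * κ ^ N * ‖s‖ ^ 2) +
              C * (2 * R * ‖s‖) * (M * κ ^ N * ‖s‖ ^ 2 + B * κ ^ N * ‖s‖) := by
              gcongr
              exact (norm_fst_le _).trans hqd
          _ = (l * M + C * (2 * R) * ‖s‖ * M + C * (2 * R) * B) * (κ ^ N * ‖s‖ ^ 2) := by ring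
          _ ≤ (l * M + C * (2 * R) * r * M + C * (2 * R) * B) * (κ ^ N * ‖s‖ ^ 2) := by gcongr
          _ ≤ (M * κ * l ^ 2) * (κ ^ N * ‖s‖ ^ 2) := by
              gcongr
              linarith [mul_le_mul_of_nonneg_right hCr hM0.le]
          _ = _ := by ring
      · have e3 : ((Λ * (h (N + 1) s).1, μ * (h (N + 1) s).2) + q (h (N + 1) s)).2 -
            ((Λ * (h N s).1, μ * (h N s).2) + q (h N s)).2 =
            μ * ((h (N + 1) s).2 - (h N s).2) + (q (h (N + 1) s) - q (h N s)).2 := by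
          simp only [Prod.snd_add, Prod.snd_sub]
          ring
        rw [e3, hts]
        refine (norm_add_le _ _).trans ?_
        rw [norm_mul]
        have hs1 : ‖s‖ ≤ 1 := hsr.trans hr1
        calc _ ≤ ‖μ‖ * (B * κ ^ N * ‖s‖) +
              C * (2 * R * ‖s‖) * (M * κ ^ N * ‖s‖ ^ 2 + B * κ ^ N * ‖s‖) := by
              gcongr
              exact (norm_snd_le _).trans hqd
          _ = (‖μ‖ * B + C * (2 * R) * (M * ‖s‖ + B) * ‖s‖) * (κ ^ N * ‖s‖) := by ring
          _ ≤ (‖μ‖ * B + C * (2 * R) * (M * 1 + B) * r) * (κ ^ N * ‖s‖) := by gcongr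
          _ ≤ (B * κ * l) * (κ ^ N * ‖s‖) := by
              gcongr
              linarith
          _ = _ := by ring
  refine ⟨r, hr, M + B, fun N t ht => ?_⟩
  obtain ⟨d1, d2⟩ := diff N t ht
  have ht0 := norm_nonneg t
  have ht1 := ht.trans hr1
  have hk : 0 < κ ^ N := by positivity
  rw [Prod.norm_def]
  refine max_le (d1.trans ?_) (d2.trans ?_)
  · calc _ ≤ M * κ ^ N * 1 ^ 2 := by gcongr
      _ ≤ _ := by linarith [mul_pos hB0 hk]
  · calc _ ≤ B * κ ^ N * 1 := by gcongr
      _ ≤ _ := by linarith [mul_pos hM0 hk]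

/-- A sequence of functions with geometrically decaying increments on a ball converges
continuously at each interior point. -/
theorem exists_tendsto_of_norm_succ_sub_le_geometric {E : Type*} [NormedAddCommGroup E]
    [CompleteSpace E] {h : ℕ → ℂ → E} {κ M r : ℝ} (hκ₀ : 0 ≤ κ) (hκ : κ < 1)
    (hcont : ∀ N, Continuous (h N))
    (hh : ∀ N t, ‖t‖ ≤ r → ‖h (N + 1) t - h N t‖ ≤ M * κ ^ N) {x : ℂ} (hx : ‖x‖ < r) :
    ∃ v, Tendsto (fun p : ℕ × ℂ => h p.1 p.2) (atTop ×ˢ 𝓝 x) (𝓝 v) := by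
  have hd : ∀ t, ‖t‖ ≤ r → ∀ n, dist (h n t) (h (n + 1) t) ≤ M * κ ^ n := fun t ht n => by
    rw [dist_comm, dist_eq_norm]
    exact hh n t ht
  have hlim : ∀ t, ∃ v, ‖t‖ ≤ r → Tendsto (fun n => h n t) atTop (𝓝 v) := by
    intro t
    by_cases ht : ‖t‖ ≤ r
    · obtain ⟨v, hv⟩ :=
        cauchySeq_tendsto_of_complete (cauchySeq_of_le_geometric κ M hκ (hd t ht))
      exact ⟨v, fun _ => hv⟩
    · exact ⟨0, fun h => absurd h ht⟩
  choose g hg using hlim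
  have hmem : {t : ℂ | ‖t‖ ≤ r} ∈ 𝓝 x := by
    filter_upwards [(isOpen_lt continuous_norm continuous_const).mem_nhds hx] with t ht
    exact le_of_lt ht
  have hunif : TendstoUniformlyOn h g atTop {t | ‖t‖ ≤ r} := by
    have h0 : Tendsto (fun n => M * κ ^ n / (1 - κ)) atTop (𝓝 0) := by
      simpa using ((tendsto_pow_atTop_nhds_zero_of_lt_one hκ₀ hκ).const_mul M).div_const (1 - κ)
    rw [Metric.tendstoUniformlyOn_iff]
    intro ε hε
    filter_upwards [h0.eventually_lt_const hε] with n hn t ht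
    rw [dist_comm]
    exact (dist_le_of_le_geometric_of_tendsto κ M hκ (hd t ht) (hg t ht) n).trans_lt hn
  have hgc : ContinuousAt g x :=
    (hunif.continuousOn (Eventually.of_forall fun n =>
      (hcont n).continuousOn).frequently).continuousAt hmem
  refine ⟨g x, ?_⟩
  rw [Metric.tendsto_nhds]
  intro ε hε
  have e1 := Metric.tendstoUniformlyOn_iff.1 hunif (ε / 2) (half_pos hε)
  have e2 := Metric.tendsto_nhds.1 hgc (ε / 2) (half_pos hε)
  filter_upwards [e1.prod_mk (e2.and hmem)] with p hp
  have := dist_triangle (h p.1 p.2) (g p.2) (g x)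
  have h1 := hp.1 p.2 hp.2.2
  rw [dist_comm] at h1
  linarith [hp.2.1]

/-- Continuous convergence near the origin spreads to the whole plane along a functional equation
`G (N + 1) (Λ t) = F (G N t)` with an expanding `Λ`. -/
theorem exists_tendsto_of_rescaling {X : Type*} [TopologicalSpace X] {Λ : ℂ} (hΛ : 1 < ‖Λ‖)
    {F : X → X} (hF : Continuous F) {G : ℕ → ℂ → X}
    (hG : ∀ N t, G (N + 1) (Λ * t) = F (G N t)) {r : ℝ} (hr : 0 < r)
    (hloc : ∀ x : ℂ, ‖x‖ < r →
      ∃ v, Tendsto (fun p : ℕ × ℂ => G p.1 p.2) (atTop ×ˢ 𝓝 x) (𝓝 v)) (x : ℂ) :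
    ∃ v, Tendsto (fun p : ℕ × ℂ => G p.1 p.2) (atTop ×ˢ 𝓝 x) (𝓝 v) := by
  have hΛ0 : Λ ≠ 0 := norm_pos_iff.1 (one_pos.trans hΛ)
  have key : ∀ k : ℕ, ∀ x : ℂ, ‖x‖ < r * ‖Λ‖ ^ k →
      ∃ v, Tendsto (fun p : ℕ × ℂ => G p.1 p.2) (atTop ×ˢ 𝓝 x) (𝓝 v) := by
    intro k
    induction k with
    | zero => simpa using hloc
    | succ k ih =>
      intro x hx
      obtain ⟨v, hv⟩ := ih (x / Λ) (by
        rw [norm_div, div_lt_iff₀ (by positivity)]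
        rwa [pow_succ, ← mul_assoc] at hx)
      have hshift : Tendsto (fun p : ℕ × ℂ => (p.1 - 1, p.2 / Λ)) (atTop ×ˢ 𝓝 x)
          (atTop ×ˢ 𝓝 (x / Λ)) :=
        (tendsto_sub_atTop_nat 1).prodMap ((continuous_id.div_const Λ).tendsto x)
      refine ⟨F v, ((hF.tendsto v).comp (hv.comp hshift)).congr' ?_⟩
      filter_upwards [tendsto_fst.eventually (eventually_ge_atTop 1)] with p hp
      simp only [Function.comp]
      rw [← hG, Nat.sub_add_cancel hp, mul_div_cancel₀ _ hΛ0]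
  obtain ⟨k, hk⟩ := pow_unbounded_of_one_lt (‖x‖ / r) hΛ
  exact key k x (by rwa [div_lt_iff₀' hr] at hk)

/-- Continuous convergence at every point implies locally uniform convergence. -/
theorem tendstoLocallyUniformly_of_forall_tendsto_prod {X : Type*} [PseudoMetricSpace X]
    {G : ℕ → ℂ → X} {g : ℂ → X}
    (h : ∀ x, Tendsto (fun p : ℕ × ℂ => G p.1 p.2) (atTop ×ˢ 𝓝 x) (𝓝 (g x))) :
    TendstoLocallyUniformly G g atTop := by
  rw [Metric.tendstoLocallyUniformly_iff]
  intro ε hε x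
  have hlim : ∀ y, Tendsto (fun n => G n y) atTop (𝓝 (g y)) := fun y =>
    (h y).comp (tendsto_id.prodMk (tendsto_const_nhds))
  obtain ⟨p, hp, U, hU, hpU⟩ :=
    eventually_prod_iff.1 (Metric.tendsto_nhds.1 (h x) (ε / 3) (by positivity))
  refine ⟨{y | U y}, hU, ?_⟩
  filter_upwards [hp] with n hn y hy
  have h1 : dist (g y) (g x) ≤ ε / 3 :=
    le_of_tendsto ((hlim y).dist tendsto_const_nhds) (hp.mono fun m hm => (hpU hm hy).le)
  have h2 : dist (G n y) (g x) < ε / 3 := hpU hn hy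
  linarith [dist_triangle_right (g y) (G n y) (g x)]

theorem norm_mul_sub_mul_le {x y x' y' : ℂ} {A B a b : ℝ} (hx : ‖x‖ ≤ A) (hy' : ‖y'‖ ≤ B)
    (hxx : ‖x - x'‖ ≤ a) (hyy : ‖y - y'‖ ≤ b) : ‖x * y - x' * y'‖ ≤ A * b + a * B := by
  have e : x * y - x' * y' = x * (y - y') + (x - x') * y' := by ring
  rw [e]
  refine (norm_add_le _ _).trans ?_
  rw [norm_mul, norm_mul]
  have := (norm_nonneg _).trans hx
  have := (norm_nonneg _).trans hxx
  gcongr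

/-- The pair (Φ¹, Φ²) as a self-map of ℂ². -/
noncomputable def PhiPair (z : ℂ × ℂ) : ℂ × ℂ := (Phi1C z.1 z.2, Phi2C z.1 z.2)

/-- The part of (Φ¹, Φ²) of degree at least two around the fixed point (1, 1). -/
noncomputable def PhiNonlinear (z : ℂ × ℂ) : ℂ × ℂ :=
  ((29 * (z.1 * z.1) + 12 * (z.1 * z.2) + z.2 * z.2 + 2 * (z.1 * (z.1 * z.2)) +
      4 * (z.1 * (z.1 * z.1))) / 30,
    (43 * (z.1 * z.1) + 49 * (z.1 * z.2) + 7 * (z.2 * z.2) + 14 * (z.1 * (z.1 * z.2)) +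
      8 * (z.1 * (z.1 * z.1)) + 5 * (z.1 * (z.2 * z.2))) / 45)

/-- Coordinates diagonalizing the derivative of (Φ¹, Φ²) at (1, 1). -/
noncomputable def eigenCoord (z : ℂ × ℂ) : ℂ × ℂ :=
  (z.1 + ((√205 : ℝ) - 7) / 26 * z.2, z.1 - ((√205 : ℝ) + 7) / 26 * z.2)

/-- The inverse of `eigenCoord`. -/
noncomputable def eigenCoordInv (w : ℂ × ℂ) : ℂ × ℂ :=
  (w.1 - ((√205 : ℝ) - 7) / 26 * (13 / (√205 : ℝ) * (w.1 - w.2)),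
    13 / (√205 : ℝ) * (w.1 - w.2))

/-- The contracting eigenvalue of the derivative of (Φ¹, Φ²) at (1, 1). -/
noncomputable def lamConj : ℝ := (20 - √205) / 15

theorem sqrt_205_bounds : 14 < √205 ∧ √205 < 15 := by
  constructor
  · exact Real.lt_sqrt_of_sq_lt (by norm_num)
  · rw [Real.sqrt_lt' (by norm_num)]
    norm_num

theorem ofReal_sqrt_205_sq : ((√205 : ℝ) : ℂ) ^ 2 = 205 := by
  rw [← Complex.ofReal_pow, Real.sq_sqrt (by norm_num)]
  norm_num

theorem ofReal_sqrt_205_ne_zero : ((√205 : ℝ) : ℂ) ≠ 0 := by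
  rw [Complex.ofReal_ne_zero]
  linarith [sqrt_205_bounds.1]

theorem norm_sqrt_205_sub_div_le : ‖(((√205 : ℝ) : ℂ) - 7) / 26‖ ≤ 1 / 2 := by
  obtain ⟨h1, h2⟩ := sqrt_205_bounds
  have e : (((√205 : ℝ) : ℂ) - 7) / 26 = (((√205 - 7) / 26 : ℝ) : ℂ) := by push_cast; rfl
  rw [e, Complex.norm_real, Real.norm_eq_abs, abs_le]
  constructor <;> linarith

theorem norm_sqrt_205_add_div_le : ‖(((√205 : ℝ) : ℂ) + 7) / 26‖ ≤ 1 := by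
  obtain ⟨h1, h2⟩ := sqrt_205_bounds
  have e : (((√205 : ℝ) : ℂ) + 7) / 26 = (((√205 + 7) / 26 : ℝ) : ℂ) := by push_cast; rfl
  rw [e, Complex.norm_real, Real.norm_eq_abs, abs_le]
  constructor <;> linarith

theorem eigenCoordInv_eigenCoord (z : ℂ × ℂ) : eigenCoordInv (eigenCoord z) = z := by
  have := ofReal_sqrt_205_ne_zero
  ext
  · simp only [eigenCoord, eigenCoordInv]
    field_simp
    ring
  · simp only [eigenCoord, eigenCoordInv]
    field_simp
    ring

theorem eigenCoord_sub (z w : ℂ × ℂ) : eigenCoord (z - w) = eigenCoord z - eigenCoord w := by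
  ext <;> simp only [eigenCoord, Prod.fst_sub, Prod.snd_sub] <;> ring

theorem eigenCoordInv_sub (z w : ℂ × ℂ) :
    eigenCoordInv (z - w) = eigenCoordInv z - eigenCoordInv w := by
  ext <;> simp only [eigenCoordInv, Prod.fst_sub, Prod.snd_sub] <;> ring

theorem norm_eigenCoord_le (z : ℂ × ℂ) : ‖eigenCoord z‖ ≤ 2 * ‖z‖ := by
  have h1 := norm_fst_le z
  have h2 := norm_snd_le z
  have h0 := norm_nonneg z
  rw [eigenCoord, Prod.norm_mk]
  refine max_le ((norm_add_le _ _).trans ?_) ((norm_sub_le _ _).trans ?_)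
  · rw [norm_mul]
    have := mul_le_mul norm_sqrt_205_sub_div_le h2 (norm_nonneg _) (by norm_num)
    linarith
  · rw [norm_mul]
    have := mul_le_mul norm_sqrt_205_add_div_le h2 (norm_nonneg _) (by norm_num)
    linarith

theorem norm_eigenCoordInv_le (w : ℂ × ℂ) : ‖eigenCoordInv w‖ ≤ 2 * ‖w‖ := by
  have h1 := norm_fst_le w
  have h2 := norm_snd_le w
  have h3 : ‖(13 / (√205 : ℝ) : ℂ) * (w.1 - w.2)‖ ≤ 2 * ‖w‖ := by
    have e : ‖(13 / (√205 : ℝ) : ℂ)‖ ≤ 1 := by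
      rw [norm_div, Complex.norm_real, Real.norm_of_nonneg (Real.sqrt_nonneg _)]
      rw [div_le_one (by linarith [sqrt_205_bounds.1])]
      norm_num
      linarith [sqrt_205_bounds.1]
    rw [norm_mul]
    have := mul_le_mul e (norm_sub_le w.1 w.2) (norm_nonneg _) zero_le_one
    linarith
  rw [eigenCoordInv, Prod.norm_mk]
  refine max_le ((norm_sub_le _ _).trans ?_) h3
  rw [norm_mul]
  have := mul_le_mul norm_sqrt_205_sub_div_le h3 (norm_nonneg _) (by norm_num)
  linarith

theorem eigenCoord_PhiPair_sub_one (z : ℂ × ℂ) : eigenCoord (PhiPair z - 1) =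
    (lam * (eigenCoord (z - 1)).1, lamConj * (eigenCoord (z - 1)).2) +
      eigenCoord (PhiNonlinear (z - 1)) := by
  have hs := ofReal_sqrt_205_sq
  ext
  · simp only [eigenCoord, PhiPair, PhiNonlinear, Phi1C, Phi2C, lam, Prod.fst_add, Prod.fst_sub,
      Prod.snd_sub, Prod.fst_one, Prod.snd_one]
    push_cast
    linear_combination (1 - z.2) / 390 * hs
  · simp only [eigenCoord, PhiPair, PhiNonlinear, Phi1C, Phi2C, lamConj, Prod.snd_add,
      Prod.fst_sub, Prod.snd_sub, Prod.fst_one, Prod.snd_one]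
    push_cast
    linear_combination (1 - z.2) / 390 * hs

theorem norm_PhiNonlinear_sub_le {m : ℝ} (hm : m ≤ 1) {z w : ℂ × ℂ} (hz : ‖z‖ ≤ m)
    (hw : ‖w‖ ≤ m) : ‖PhiNonlinear z - PhiNonlinear w‖ ≤ 7 * m * ‖z - w‖ := by
  obtain ⟨x, y⟩ := z
  obtain ⟨x', y'⟩ := w
  set d := ‖((x, y) : ℂ × ℂ) - (x', y')‖ with hd
  have hd0 : 0 ≤ d := norm_nonneg _
  have hm0 : 0 ≤ m := (norm_nonneg _).trans hz
  have hx : ‖x‖ ≤ m := (norm_fst_le (x, y)).trans hz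
  have hy : ‖y‖ ≤ m := (norm_snd_le (x, y)).trans hz
  have hx' : ‖x'‖ ≤ m := (norm_fst_le (x', y')).trans hw
  have hy' : ‖y'‖ ≤ m := (norm_snd_le (x', y')).trans hw
  have hxd : ‖x - x'‖ ≤ d := norm_fst_le (((x, y) : ℂ × ℂ) - (x', y'))
  have hyd : ‖y - y'‖ ≤ d := norm_snd_le (((x, y) : ℂ × ℂ) - (x', y'))
  have hmm : m * m ≤ m := by nlinarith
  have hmd := mul_le_mul_of_nonneg_right hmm hd0
  have sq : ∀ {u v : ℂ}, ‖u‖ ≤ m → ‖v‖ ≤ m → ‖u * v‖ ≤ m * m := fun hu hv => by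
    rw [norm_mul]
    gcongr
  have xx := norm_mul_sub_mul_le hx hx' hxd hxd
  have xy := norm_mul_sub_mul_le hx hy' hxd hyd
  have yy := norm_mul_sub_mul_le hy hy' hyd hyd
  have xxx := norm_mul_sub_mul_le hx (sq hx' hx') hxd xx
  have xxy := norm_mul_sub_mul_le hx (sq hx' hy') hxd xy
  have xyy := norm_mul_sub_mul_le hx (sq hy' hy') hxd yy
  have smul_le : ∀ {u : ℂ} {c : ℝ} (k : ℕ), ‖u‖ ≤ c → ‖(k : ℂ) * u‖ ≤ k * c := fun k hu => by
    rw [norm_mul, Complex.norm_natCast]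
    gcongr
  rw [Prod.norm_def]
  refine max_le ?_ ?_
  · have e : (PhiNonlinear (x, y) - PhiNonlinear (x', y')).1 =
        ((29 : ℕ) * (x * x - x' * x') + (12 : ℕ) * (x * y - x' * y') + (y * y - y' * y') +
          (2 : ℕ) * (x * (x * y) - x' * (x' * y')) +
          (4 : ℕ) * (x * (x * x) - x' * (x' * x'))) / (30 : ℕ) := by
      simp only [PhiNonlinear, Prod.fst_sub]
      push_cast
      ring
    rw [e, norm_div, Complex.norm_natCast, div_le_iff₀ (by norm_num)]
    refine (norm_add_le_of_le (norm_add_le_of_le (norm_add_le_of_le (norm_add_le_of_le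
      (smul_le _ xx) (smul_le _ xy)) yy) (smul_le _ xxy)) (smul_le _ xxx)).trans ?_
    push_cast
    nlinarith [mul_nonneg hm0 hd0]
  · have e : (PhiNonlinear (x, y) - PhiNonlinear (x', y')).2 =
        ((43 : ℕ) * (x * x - x' * x') + (49 : ℕ) * (x * y - x' * y') +
          (7 : ℕ) * (y * y - y' * y') + (14 : ℕ) * (x * (x * y) - x' * (x' * y')) +
          (8 : ℕ) * (x * (x * x) - x' * (x' * x')) +
          (5 : ℕ) * (x * (y * y) - x' * (y' * y'))) / (45 : ℕ) := by
      simp only [PhiNonlinear, Prod.snd_sub]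
      push_cast
      ring
    rw [e, norm_div, Complex.norm_natCast, div_le_iff₀ (by norm_num)]
    refine (norm_add_le_of_le (norm_add_le_of_le (norm_add_le_of_le (norm_add_le_of_le
      (norm_add_le_of_le (smul_le _ xx) (smul_le _ xy)) (smul_le _ yy)) (smul_le _ xxy))
      (smul_le _ xxx)) (smul_le _ xyy)).trans ?_
    push_cast
    nlinarith [mul_nonneg hm0 hd0]

theorem PhiNC_eq_iterate (N : ℕ) (x y : ℂ) :
    (PhiNC 0 N x y, PhiNC 1 N x y) = PhiPair^[N] (x, y) := by
  induction N generalizing x y with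
  | zero => simp [PhiNC]
  | succ N ih =>
    rw [Function.iterate_succ_apply]
    exact ih _ _

theorem continuous_PhiPair : Continuous PhiPair := by
  unfold PhiPair Phi1C Phi2C
  fun_prop

theorem differentiable_GC (i : Fin 2) (N : ℕ) : Differentiable ℂ (GC i N) := by
  have key : ∀ (N : ℕ) (i : Fin 2) (u v : ℂ → ℂ), Differentiable ℂ u → Differentiable ℂ v →
      Differentiable ℂ fun t => PhiNC i N (u t) (v t) := by
    intro N
    induction N with
    | zero =>
      intro i u v hu hv
      by_cases hi : i = 0 <;> simpa [PhiNC, hi]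
    | succ N ih =>
      intro i u v hu hv
      refine ih i _ _ ?_ ?_
      · unfold Phi1C
        fun_prop
      · unfold Phi2C
        fun_prop
  exact key N i _ _ (by fun_prop) (by fun_prop)

theorem two_lt_lam : 2 < lam := by
  unfold lam
  linarith [sqrt_205_bounds.1]

theorem GC_pair_lam_mul (N : ℕ) (t : ℂ) : (GC 0 (N + 1) (lam * t), GC 1 (N + 1) (lam * t)) =
    PhiPair (GC 0 N t, GC 1 N t) := by
  have h0 : (lam : ℂ) ≠ 0 := by
    rw [Complex.ofReal_ne_zero]
    linarith [two_lt_lam]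
  have e1 : lam * t / (lam : ℂ) ^ (N + 1) = t / (lam : ℂ) ^ N := by
    field_simp
    ring
  have e2 : 2 * (lam * t) / (lam : ℂ) ^ (N + 1) = 2 * t / (lam : ℂ) ^ N := by
    field_simp
    ring
  unfold GC
  rw [PhiNC_eq_iterate, PhiNC_eq_iterate, e1, e2, Function.iterate_succ_apply']

theorem exists_tendsto_GC_pair (x : ℂ) : ∃ v : ℂ × ℂ,
    Tendsto (fun p : ℕ × ℂ => (GC 0 p.1 p.2, GC 1 p.1 p.2)) (atTop ×ˢ 𝓝 x) (𝓝 v) := by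
  have hlam := two_lt_lam
  have hnorm : ‖(lam : ℂ)‖ = lam := by
    rw [Complex.norm_real, Real.norm_of_nonneg (by linarith)]
  have hconj : ‖(lamConj : ℂ)‖ < 1 / 2 * lam := by
    rw [Complex.norm_real, Real.norm_eq_abs, abs_lt, lamConj, lam]
    obtain ⟨h1, h2⟩ := sqrt_205_bounds
    constructor <;> linarith
  set G : ℕ → ℂ → ℂ × ℂ := fun N t => (GC 0 N t, GC 1 N t) with hG
  have hGcont : ∀ N, Continuous (G N) := fun N =>
    (differentiable_GC 0 N).continuous.prodMk (differentiable_GC 1 N).continuous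
  have hinv : ∀ N t, G N t = 1 + eigenCoordInv (eigenCoord (G N t - 1)) := fun N t => by
    rw [eigenCoordInv_eigenCoord, add_sub_cancel]
  have hec : Continuous eigenCoord := by
    unfold eigenCoord
    fun_prop
  have heci : Continuous eigenCoordInv := by
    unfold eigenCoordInv
    fun_prop
  have hN0 : PhiNonlinear 0 = 0 := by simp [PhiNonlinear]
  have hI0 : eigenCoordInv 0 = 0 := by simp [eigenCoordInv]
  have hE0 : eigenCoord 0 = 0 := by simp [eigenCoord]
  have hx : ∀ t : ℂ, ‖t‖ ≤ 1 / 2 →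
      ‖(G 0 t - 1).1‖ ≤ 2 * ‖t‖ ∧ ‖(G 0 t - 1).1 + t‖ ≤ ‖t‖ ^ 2 := by
    intro t ht
    have e : (G 0 t - 1).1 = Complex.exp (-t) - 1 := by simp [hG, GC, PhiNC]
    have h1 := Complex.norm_exp_sub_one_le (x := -t) (by rw [norm_neg]; linarith)
    have h2 := Complex.norm_exp_sub_one_sub_id_le (x := -t) (by rw [norm_neg]; linarith)
    rw [norm_neg] at h1 h2
    rw [e]
    exact ⟨h1, by simpa using h2⟩
  have hy : ∀ t : ℂ, ‖t‖ ≤ 1 / 2 →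
      ‖(G 0 t - 1).2‖ ≤ 4 * ‖t‖ ∧ ‖(G 0 t - 1).2 + 2 * t‖ ≤ 4 * ‖t‖ ^ 2 := by
    intro t ht
    have e : (G 0 t - 1).2 = Complex.exp (-(2 * t)) - 1 := by simp [hG, GC, PhiNC]
    have hn : ‖-(2 * t)‖ = 2 * ‖t‖ := by simp
    have h1 := Complex.norm_exp_sub_one_le (x := -(2 * t)) (by rw [hn]; linarith)
    have h2 := Complex.norm_exp_sub_one_sub_id_le (x := -(2 * t)) (by rw [hn]; linarith)
    rw [hn] at h1 h2
    rw [sub_neg_eq_add] at h2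
    rw [e]
    exact ⟨by linarith, by linarith⟩
  obtain ⟨r, hr, M, hM⟩ : ∃ r > 0, ∃ M, ∀ N t, ‖t‖ ≤ r →
      ‖eigenCoord (G (N + 1) t - 1) - eigenCoord (G N t - 1)‖ ≤ M * (1 / 2) ^ N := by
    refine exists_norm_succ_sub_le_geometric (Λ := lam) (μ := lamConj)
      (c := -(1 + 2 * (((√205 : ℝ) - 7) / 26))) (κ := 1 / 2) (C := 56) (ρ := 1 / 2) (R := 8)
      (r₀ := 1 / 2) (h := fun N t => eigenCoord (G N t - 1))
      (q := fun w => eigenCoord (PhiNonlinear (eigenCoordInv w)))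
      (by rw [hnorm]; linarith) (by rw [hnorm]; linarith) (by norm_num) (by rw [hnorm]; linarith)
      (by rw [hnorm]; exact hconj) (by norm_num) (by norm_num) (by norm_num) (by norm_num)
      (by simp only [hI0, hN0, hE0]) ?_ ?_ ?_ ?_
    · intro m z w hm hz hw
      have h1 := norm_PhiNonlinear_sub_le (m := 2 * m) (by linarith)
        ((norm_eigenCoordInv_le z).trans (by linarith))
        ((norm_eigenCoordInv_le w).trans (by linarith))
      have h2 := norm_eigenCoordInv_le (z - w)
      have hm0 := (norm_nonneg _).trans hz
      rw [← eigenCoordInv_sub] at h1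
      rw [← eigenCoord_sub]
      refine (norm_eigenCoord_le _).trans ?_
      have := mul_le_mul_of_nonneg_left h2 hm0
      linarith
    · intro N t
      simp only [hG, GC_pair_lam_mul, eigenCoord_PhiPair_sub_one, eigenCoordInv_eigenCoord]
    · intro t ht
      refine (norm_eigenCoord_le _).trans ?_
      have : ‖G 0 t - 1‖ ≤ 4 * ‖t‖ := by
        rw [Prod.norm_def]
        exact max_le (by linarith [(hx t ht).1, norm_nonneg t]) (hy t ht).1
      linarith
    · intro t ht
      have e : (eigenCoord (G 0 t - 1)).1 - -(1 + 2 * (((√205 : ℝ) - 7) / 26 : ℂ)) * t =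
          ((G 0 t - 1).1 + t) + ((√205 : ℝ) - 7) / 26 * ((G 0 t - 1).2 + 2 * t) := by
        simp only [eigenCoord]
        ring
      rw [e]
      refine (norm_add_le _ _).trans ?_
      rw [norm_mul]
      have h1 := mul_le_mul norm_sqrt_205_sub_div_le (hy t ht).2 (norm_nonneg _) (by norm_num)
      nlinarith [(hx t ht).2, sq_nonneg ‖t‖]
  refine exists_tendsto_of_rescaling (G := G) (Λ := lam) (by rw [hnorm]; linarith)
    continuous_PhiPair GC_pair_lam_mul hr (fun x hx => ?_) x
  obtain ⟨v, hv⟩ := exists_tendsto_of_norm_succ_sub_le_geometric (by norm_num) (by norm_num)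
    (fun N => hec.comp ((hGcont N).sub continuous_const)) hM hx
  refine ⟨1 + eigenCoordInv v, ?_⟩
  refine (((continuous_const.add heci).tendsto v).comp hv).congr fun p => ?_
  exact (hinv p.1 p.2).symm

/-- There exist entire functions g₁, g₂ : ℂ → ℂ with g₁(0) = g₂(0) = 1 such that
G_N^{(i)} → g_i uniformly on every compact subset of ℂ as N → ∞, and
g₁(λt) = Φ¹(g₁(t), g₂(t)), g₂(λt) = Φ²(g₁(t), g₂(t)) for all t ∈ ℂ. -/
theorem GC_tendsto_entire_limits :
    ∃ g : Fin 2 → ℂ → ℂ,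
      (∀ i, Differentiable ℂ (g i)) ∧
      g 0 0 = 1 ∧ g 1 0 = 1 ∧
      (∀ i, ∀ K : Set ℂ, IsCompact K →
        TendstoUniformlyOn (fun N : ℕ => GC i N) (g i) Filter.atTop K) ∧
      (∀ t : ℂ, g 0 ((lam : ℂ) * t) = Phi1C (g 0 t) (g 1 t) ∧
                g 1 ((lam : ℂ) * t) = Phi2C (g 0 t) (g 1 t)) := by
  choose v hv using exists_tendsto_GC_pair
  have hloc : ∀ i : Fin 2, TendstoLocallyUniformly (fun N => GC i N)
      (fun t => if i = 0 then (v t).1 else (v t).2) atTop := by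
    intro i
    refine tendstoLocallyUniformly_of_forall_tendsto_prod fun x => ?_
    fin_cases i
    · exact (continuous_fst.tendsto _).comp (hv x)
    · exact (continuous_snd.tendsto _).comp (hv x)
  have hpt : ∀ t, Tendsto (fun N => (GC 0 N t, GC 1 N t)) atTop (𝓝 (v t)) := fun t =>
    (hv t).comp (tendsto_id.prodMk tendsto_const_nhds)
  have hfun : ∀ t, v (lam * t) = PhiPair (v t) := fun t =>
    tendsto_nhds_unique ((hpt (lam * t)).comp (tendsto_add_atTop_nat 1))
      (((continuous_PhiPair.tendsto _).comp (hpt t)).congr fun N => (GC_pair_lam_mul N t).symm)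
  have hv0 : v 0 = (1, 1) := by
    have hG0 : ∀ N, (GC 0 N 0, GC 1 N 0) = ((1, 1) : ℂ × ℂ) := by
      intro N
      induction N with
      | zero => simp [GC, PhiNC]
      | succ N ih =>
        have := GC_pair_lam_mul N 0
        rw [mul_zero] at this
        rw [this, ih]
        norm_num [PhiPair, Phi1C, Phi2C]
    exact tendsto_nhds_unique (hpt 0) (by simp only [hG0, tendsto_const_nhds])
  refine ⟨fun i t => if i = 0 then (v t).1 else (v t).2, fun i => ?_, ?_, ?_, fun i K hK => ?_,
    fun t => ?_⟩
  · rw [← differentiableOn_univ]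
    exact (tendstoLocallyUniformlyOn_univ.2 (hloc i)).differentiableOn
      (Eventually.of_forall fun N => (differentiable_GC i N).differentiableOn) isOpen_univ
  · simp [hv0]
  · simp [hv0]
  · exact (tendstoLocallyUniformlyOn_iff_tendstoUniformlyOn_of_compact hK).1
      ((hloc i).tendstoLocallyUniformlyOn)
  · simp [hfun t, PhiPair]
end
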